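/- Let K be a compact metrizable group and Γ a group of continuous automorphisms of K. Suppose there is a collection (K_i)_{i∈I} of closed Γ-invariant subgroups of K such that the closure of ∪_{i∈I} K_i equals K and the restricted action of Γ on K_i is ergodic for every i ∈ I. Then Γ is ergodic on K. -/

import Mathlib

open MeasureTheory Topology Set

set_option linter.unusedVariables false

namespace ErgZd

variable {K : Type*}

/-- The group of bi-continuous automorphisms of a topological group,
as a subgroup of `MulAut K`. -/
def ContAut (K : Type*) [Group K] [TopologicalSpace K] : Subgroup (MulAut K) where
  carrier := {α | Continuous α ∧ Continuous α.symm}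
  one_mem' := ⟨continuous_id, continuous_id⟩
  mul_mem' := fun {a b} ha hb => ⟨ha.1.comp hb.1, hb.2.comp ha.2⟩
  inv_mem' := fun {a} ha => ⟨ha.2, ha.1⟩

section Defs

variable [Group K] [TopologicalSpace K]

lemma ContAut.continuous (α : ↥(ContAut K)) : Continuous ⇑(α : MulAut K) := α.2.1

lemma ContAut.continuous_symm (α : ↥(ContAut K)) :
    Continuous ⇑(α : MulAut K).symm := α.2.2

/-- Ergodicity of the action of a set `S` of automorphisms with respect to `μ`:
every invariant Borel set is null or conull. -/
def ErgSet [MeasurableSpace K] (μ : Measure K) (S : Set ↥(ContAut K)) : Prop :=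
  ∀ A : Set K, MeasurableSet A → (∀ α ∈ S, (α : MulAut K) '' A = A) → μ A = 0 ∨ μ A = 1

/-- Ergodicity of a single automorphism: ergodicity of the group of its integer powers. -/
def ErgAut [MeasurableSpace K] (μ : Measure K) (α : ↥(ContAut K)) : Prop :=
  ErgSet μ (Set.range fun n : ℤ => α ^ n)

/-- Distality of the action of a set of automorphisms: for `x ≠ 1`, the identity is
not in the closure of the orbit of `x`. -/
def DistalSet (S : Set ↥(ContAut K)) : Prop :=
  ∀ x : K, x ≠ 1 → (1 : K) ∉ closure ((fun α : ↥(ContAut K) => (α : MulAut K) x) '' S)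

/-- Distality of a single automorphism. -/
def DistalAut (α : ↥(ContAut K)) : Prop := DistalSet (Set.range fun n : ℤ => α ^ n)

/-- The descending chain condition for an action: every decreasing
sequence of closed invariant subgroups is eventually constant. -/
def HasDCC (S : Set ↥(ContAut K)) : Prop :=
  ∀ C : ℕ → Subgroup K, (∀ n, IsClosed (C n : Set K)) → (∀ n, C (n + 1) ≤ C n) →
    (∀ n, ∀ α ∈ S, ∀ x, x ∈ C n ↔ (α : MulAut K) x ∈ C n) → ∃ N, ∀ n, N ≤ n → C n = C N

/-- Restriction of an automorphism to an invariant subgroup. -/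
def restrictAut (H : Subgroup K) (α : ↥(ContAut K))
    (h : ∀ x, x ∈ H ↔ (α : MulAut K) x ∈ H) : ↥(ContAut ↥H) := by
  refine ⟨⟨⟨fun x => ⟨(α : MulAut K) x, (h x).mp x.2⟩,
      fun x => ⟨(α : MulAut K).symm x, (h _).mpr (by simpa using x.2)⟩, ?_, ?_⟩, ?_⟩, ?_, ?_⟩
  · intro x; ext; simp
  · intro x; ext; simp
  · intro x y; ext; simp
  · exact Continuous.subtype_mk ((ContAut.continuous α).comp continuous_subtype_val) _
  · exact Continuous.subtype_mk ((ContAut.continuous_symm α).comp continuous_subtype_val) _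

@[simp] lemma restrictAut_coe (H : Subgroup K) (α : ↥(ContAut K))
    (h : ∀ x, x ∈ H ↔ (α : MulAut K) x ∈ H) (x : ↥H) :
    ((((restrictAut H α h) : MulAut ↥H) x : ↥H) : K) = (α : MulAut K) (x : K) := rfl

/-- The automorphism induced on the quotient by an invariant closed normal subgroup. -/
def quotAut (N : Subgroup K) [N.Normal] (α : ↥(ContAut K))
    (h : ∀ x, x ∈ N ↔ (α : MulAut K) x ∈ N) : ↥(ContAut (K ⧸ N)) := by
  have hmap : N.map ((α : MulAut K) : K ≃* K) = N := by
    ext y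
    constructor
    · rintro ⟨x, hx, rfl⟩; exact (h x).mp hx
    · intro hy
      exact ⟨(α : MulAut K).symm y, (h _).mpr (by simpa using hy), by simp⟩
  refine ⟨QuotientGroup.congr N N ((α : MulAut K) : K ≃* K) hmap, ?_, ?_⟩
  · apply (QuotientGroup.isQuotientMap_mk N).continuous_iff.mpr
    have : ⇑(QuotientGroup.congr N N ((α : MulAut K) : K ≃* K) hmap) ∘ (QuotientGroup.mk : K → K ⧸ N)
        = (QuotientGroup.mk : K → K ⧸ N) ∘ ⇑(α : MulAut K) := by
      funext x
      exact QuotientGroup.congr_mk N N _ hmap x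
    rw [this]
    exact QuotientGroup.continuous_mk.comp (ContAut.continuous α)
  · apply (QuotientGroup.isQuotientMap_mk N).continuous_iff.mpr
    have : ⇑(QuotientGroup.congr N N ((α : MulAut K) : K ≃* K) hmap).symm ∘ (QuotientGroup.mk : K → K ⧸ N)
        = (QuotientGroup.mk : K → K ⧸ N) ∘ ⇑((α : MulAut K) : K ≃* K).symm := by
      funext x
      rfl
    rw [this]
    exact QuotientGroup.continuous_mk.comp (ContAut.continuous_symm α)

end Defs

open scoped symmDiff

/-- A continuous function invariant under an ergodic set of automorphisms is constant, provided
the measure charges every nonempty open set. -/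
lemma ErgSet.eq_of_continuous {G : Type*} [Group G] [TopologicalSpace G] [MeasurableSpace G]
    [OpensMeasurableSpace G] {ν : Measure G} [ν.IsOpenPosMeasure] [IsProbabilityMeasure ν]
    {S : Set ↥(ContAut G)} (hS : ErgSet ν S) {Y : Type*} [TopologicalSpace Y] [LinearOrder Y]
    [OrderTopology Y] [DenselyOrdered Y] {g : G → Y} (hg : Continuous g)
    (hinv : ∀ α ∈ S, ∀ x, g ((α : MulAut G) x) = g x) (x y : G) : g x = g y := by
  have measure_eq_one : ∀ U : Set Y, IsOpen U → (g ⁻¹' U).Nonempty → ν (g ⁻¹' U) = 1 := by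
    intro U hU hne
    have hopen := hU.preimage hg
    refine (hS _ hopen.measurableSet fun α hα => ?_).resolve_left (hopen.measure_pos ν hne).ne'
    ext z
    constructor
    · rintro ⟨w, hw, rfl⟩
      simpa only [mem_preimage, hinv α hα] using hw
    · intro hz
      refine ⟨(α : MulAut G).symm z, ?_, (α : MulAut G).apply_symm_apply z⟩
      rw [mem_preimage, ← hinv α hα, MulEquiv.apply_symm_apply]
      exact hz
  have not_lt : ∀ x y : G, ¬ g x < g y := by
    intro x y hxy
    obtain ⟨c, hxc, hcy⟩ := exists_between hxy
    have hdisj : Disjoint (g ⁻¹' Iio c) (g ⁻¹' Ioi c) :=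
      Disjoint.preimage g (disjoint_left.mpr fun _ h h' => lt_asymm h h')
    have hle := prob_le_one (μ := ν) (s := g ⁻¹' Iio c ∪ g ⁻¹' Ioi c)
    rw [measure_union hdisj (isOpen_Ioi.preimage hg).measurableSet,
      measure_eq_one _ isOpen_Iio ⟨x, hxc⟩, measure_eq_one _ isOpen_Ioi ⟨y, hcy⟩,
      one_add_one_eq_two] at hle
    exact absurd hle (by norm_num)
  exact le_antisymm (le_of_not_gt (not_lt y x)) (le_of_not_gt (not_lt x y))

section Compact

variable {G : Type*} [Group G] [TopologicalSpace G] [IsTopologicalGroup G] [CompactSpace G]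
  [MeasurableSpace G] [BorelSpace G] (μ : Measure G) [μ.IsHaarMeasure]

/-- Continuous automorphisms of a compact group preserve the normalized Haar measure. -/
lemma ContAut.measurePreserving [IsProbabilityMeasure μ] (α : ↥(ContAut G)) :
    MeasurePreserving (α : MulAut G) μ μ := by
  have hmeas := (ContAut.continuous α).measurable
  have := MulEquiv.isHaarMeasure_map μ (α : MulAut G) (ContAut.continuous α)
    (ContAut.continuous_symm α)
  have := Measure.isProbabilityMeasure_map (μ := μ) hmeas.aemeasurable
  exact ⟨hmeas, Measure.isHaarMeasure_eq_of_isProbabilityMeasure _ _⟩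

/-- The measure of the symmetric difference of a measurable set with its translates depends
continuously on the translation. -/
lemma continuous_measure_preimage_mul_symmDiff {A : Set G} (hA : MeasurableSet A) :
    Continuous fun x : G => μ (((fun y => x * y) ⁻¹' A) ∆ A) := by
  let F : G → MeasuredSets μ := fun x => ⟨(fun y => x * y) ⁻¹' A, measurable_const_mul x hA⟩
  have hF : Continuous F := by
    refine continuous_iff_continuousAt.mpr fun x => ?_
    rw [ContinuousAt, tendsto_iff_edist_tendsto_0]
    let f : C(G × G, G) := ⟨fun p => p.1 * p.2, continuous_mul⟩
    have hpres : ∀ z, MeasurePreserving (f.curry z) μ μ := fun z => measurePreserving_mul_left μ z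
    have hlim := tendsto_measure_symmDiff_preimage_nhds_zero (f.curry.continuous.tendsto x)
      (.of_forall hpres) (hpres x) hA.nullMeasurableSet (measure_ne_top μ A)
    exact hlim
  let B : MeasuredSets μ := ⟨A, hA⟩
  exact hF.edist (continuous_const (y := B))

/-- For an automorphism preserving `A`, the measure of the symmetric difference of `A` with its
translate by `x` is invariant under applying the automorphism to `x`. -/
lemma measure_preimage_mul_symmDiff_apply [IsProbabilityMeasure μ] {A : Set G}
    (hA : MeasurableSet A) {α : ↥(ContAut G)} (hα : (α : MulAut G) '' A = A) (x : G) :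
    μ (((fun y => (α : MulAut G) x * y) ⁻¹' A) ∆ A) = μ (((fun y => x * y) ⁻¹' A) ∆ A) := by
  have hmem : ∀ z, (α : MulAut G) z ∈ A ↔ z ∈ A := fun z => by
    conv_lhs => rw [← hα]
    exact (α : MulAut G).injective.mem_set_image
  rw [← (ContAut.measurePreserving μ α).measure_preimage
    ((measurable_const_mul _ hA).symmDiff hA).nullMeasurableSet]
  congr 1
  ext z
  simp only [mem_preimage, mem_symmDiff, ← map_mul, hmem]

end Compact

/-- Lemma 2.3. If `K` is covered (densely) by a family of closed
`Γ`-invariant subgroups on each of which (the restriction of) `Γ` is ergodic,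
then `Γ` is ergodic on `K`. -/
theorem statement2 {K : Type*} [Group K] [TopologicalSpace K] [IsTopologicalGroup K]
    [CompactSpace K] [TopologicalSpace.MetrizableSpace K]
    [MeasurableSpace K] [BorelSpace K]
    (μ : Measure K) [μ.IsHaarMeasure] [IsProbabilityMeasure μ]
    (Γ : Subgroup ↥(ContAut K))
    {I : Type*} (C : I → Subgroup K)
    (hclosed : ∀ i, IsClosed (C i : Set K))
    (hinv : ∀ i, ∀ α ∈ Γ, ∀ x : K, x ∈ C i ↔ (α : MulAut K) x ∈ C i)
    (hdense : closure (⋃ i, (C i : Set K)) = Set.univ)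
    (herg : ∀ i, ∀ ν : Measure ↥(C i), ν.IsHaarMeasure → IsProbabilityMeasure ν →
      ErgSet ν {e | ∃ α, ∃ hα : α ∈ Γ, e = restrictAut (C i) α (hinv i α hα)}) :
    ErgSet μ (Γ : Set ↥(ContAut K)) := by
  intro A hA hAinv
  have hcont := continuous_measure_preimage_mul_symmDiff μ hA
  have hzero_of_mem : ∀ i, ∀ x ∈ C i, μ (((fun y => x * y) ⁻¹' A) ∆ A) = 0 := by
    intro i x hx
    have : CompactSpace (C i) := isCompact_iff_compactSpace.mp (hclosed i).isCompact
    have hprob : IsProbabilityMeasure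
        (Measure.haarMeasure (⊤ : TopologicalSpace.PositiveCompacts (C i))) := ⟨Measure.haarMeasure_self⟩
    have hconst := (herg i (Measure.haarMeasure ⊤) inferInstance hprob).eq_of_continuous
      (hcont.comp continuous_subtype_val)
      (by
        rintro _ ⟨α, hα, rfl⟩ z
        exact measure_preimage_mul_symmDiff_apply μ hA (hAinv α hα) (z : K))
      ⟨x, hx⟩ 1
    simpa using hconst
  have hzero : ∀ x, μ (((fun y => x * y) ⁻¹' A) ∆ A) = 0 := by
    have hsub : closure (⋃ i, (C i : Set K)) ⊆ {x | μ (((fun y => x * y) ⁻¹' A) ∆ A) = 0} :=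
      closure_minimal (iUnion_subset hzero_of_mem) (isClosed_singleton.preimage hcont)
    rw [hdense] at hsub
    exact fun x => hsub (mem_univ x)
  have hae := aeconst_of_forall_preimage_smul_ae_eq K hA.nullMeasurableSet
    fun x => measure_symmDiff_eq_zero_iff.mp (hzero x)
  rw [Filter.eventuallyConst_set'] at hae
  rcases hae with h | h
  · exact Or.inl (ae_eq_empty.mp h)
  · exact Or.inr ((measure_congr h).trans measure_univ)

end ErgZd
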